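/- arXiv:0705.4085 — 2 statements merged into one kernel-verified Lean document; each statement's English description precedes it below -/
import Mathlib

section
/- Let 2 ≤ k ≤ n with gcd(n, k) = k (i.e., k divides n). Any rhythm R = {r_0, ..., r_{k-1}} of timespan n with k onsets satisfying property (★) (every clockwise distance between onsets ℓ apart lies in {⌊ℓn/k⌋, ⌈ℓn/k⌉} for all ℓ ∈ [1,k]) is a rotation of the rhythm {i·n/k : i ∈ [0, k-1]}. -/
/-- The clockwise distance from `x` to `y` on the circle `ℤ/n`
(equal to `n` when `y = x`, i.e. going once around). -/
def cw (n : ℕ) (x y : ZMod n) : ℕ := if y = x then n else (y - x).val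

/-- Property (★): for all `ℓ ∈ [1,k]` and all `i`, the clockwise distance from
`r_i` to `r_{i+ℓ}` lies in `{⌊ℓn/k⌋, ⌈ℓn/k⌉}`. -/
def StarProp (n k : ℕ) (r : ZMod k → ZMod n) : Prop :=
  ∀ l : ℕ, 1 ≤ l → l ≤ k → ∀ i : ZMod k,
    cw n (r i) (r (i + (l : ZMod k))) = l * n / k ∨
    cw n (r i) (r (i + (l : ZMod k))) = (l * n + k - 1) / k

/-- If `2 ≤ k ≤ n` and `k` divides `n`, then any rhythm with `k` onsets and
timespan `n` satisfying property (★) is a rotation of `{i·n/k : i ∈ [0,k-1]}`. -/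
theorem stmt_7 (n k : ℕ) (hk : 2 ≤ k) (hkn : k ≤ n) (hdvd : k ∣ n)
    (r : ZMod k → ZMod n) (hinj : Function.Injective r) (hstar : StarProp n k r) :
    ∃ Δ : ZMod n,
      Set.range r = Set.range (fun i : ZMod k => ((i.val * (n / k) : ℕ) : ZMod n) + Δ) := by
  obtain ⟨m, rfl⟩ := hdvd
  have hk0 : 0 < k := by omega
  haveI : NeZero k := ⟨by omega⟩
  haveI : NeZero (k * m) := ⟨by omega⟩
  have hm : k * m / k = m := Nat.mul_div_cancel_left m hk0
  have key : ∀ i : ZMod k, r i = ((i.val * (k * m / k) : ℕ) : ZMod (k * m)) + r 0 := by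
    intro i
    rw [hm]
    by_cases hi : i = 0
    · subst hi
      simp
    · have hpos : 1 ≤ i.val := by
        have : i.val ≠ 0 := fun h => hi ((ZMod.val_eq_zero i).1 h)
        omega
      have h := hstar i.val hpos (ZMod.val_lt i).le 0
      have e1 : i.val * (k * m) / k = i.val * m := by
        rw [show i.val * (k * m) = k * (i.val * m) by ring]
        exact Nat.mul_div_cancel_left _ hk0
      have e2 : (i.val * (k * m) + k - 1) / k = i.val * m := by
        rw [show i.val * (k * m) + k - 1 = (k - 1) + k * (i.val * m) by
          rw [show i.val * (k * m) = k * (i.val * m) by ring]; omega]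
        rw [Nat.add_mul_div_left _ _ hk0, Nat.div_eq_of_lt (by omega), zero_add]
      rw [e1, e2, or_self, zero_add, ZMod.natCast_zmod_val] at h
      have hne : r i ≠ r 0 := fun h' => hi (hinj h')
      rw [cw, if_neg hne] at h
      rw [← h, ZMod.natCast_zmod_val]
      ring
  exact ⟨r 0, congrArg Set.range (funext key)⟩
end

section
/- Every Erdős-deep rhythm has a shelling: there is an ordering s_1, ..., s_k of its onsets such that removing s_1, ..., s_i leaves an Erdős-deep rhythm for every i ∈ [0, k]. -/
/-- The geodesic distance between `x` and `y` on the circle `ℤ/n`. -/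
def geo (n : ℕ) (x y : ZMod n) : ℕ := min (y - x).val (x - y).val

/-- The multiset of pairwise geodesic distances between distinct onsets of `R`. -/
def pairDists (n : ℕ) (R : Finset (ZMod n)) : Multiset ℕ :=
  (R.sym2.filter fun s => ¬ s.IsDiag).val.map
    (Sym2.lift ⟨geo n, fun a b => by unfold geo; rw [min_comm]⟩)

/-- A rhythm is Erdős-deep if for each `i ∈ [1, k-1]` (where `k` is the number of
onsets) there is exactly one nonzero geodesic distance occurring exactly `i`
times in the multiset of pairwise geodesic distances. -/
def ErdosDeep (n : ℕ) (R : Finset (ZMod n)) : Prop :=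
  ∀ i : ℕ, 1 ≤ i → i ≤ R.card - 1 →
    ∃! d : ℕ, d ≠ 0 ∧ Multiset.count d (pairDists n R) = i


/-- circle norm -/
def gg (n : ℕ) (d : ZMod n) : ℕ := min d.val (-d).val

lemma geo_eq (n : ℕ) (x y : ZMod n) : geo n x y = gg n (y - x) := by
  unfold geo gg; rw [neg_sub]

lemma gg_neg (n : ℕ) (d : ZMod n) : gg n (-d) = gg n d := by
  unfold gg; rw [neg_neg, min_comm]

lemma gg_inj (n : ℕ) [NeZero n] {d e : ZMod n} (h : gg n d = gg n e) : d = e ∨ d = -e := by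
  unfold gg at h
  rcases min_choice d.val (-d).val with h1 | h1 <;> rcases min_choice e.val (-e).val with h2 | h2 <;>
    rw [h1, h2] at h <;> have h3 := ZMod.val_injective n h
  · left; exact h3
  · right; exact h3
  · right; rw [← h3, neg_neg]
  · left; exact neg_injective h3

lemma gg_zero (n : ℕ) [NeZero n] {d : ZMod n} : gg n d = 0 ↔ d = 0 := by
  constructor
  · intro h
    have : gg n d = gg n 0 := by rw [h]; simp [gg]
    rcases gg_inj n this with h | h <;> simpa using h
  · rintro rfl; simp [gg]

/-- the pairs realizing a distance -/
def prs (n : ℕ) (R : Finset (ZMod n)) (d : ℕ) : Finset (Sym2 (ZMod n)) :=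
  (R.sym2.filter fun s => ¬ s.IsDiag).filter fun s =>
    d = (Sym2.lift ⟨geo n, fun a b => by unfold geo; rw [min_comm]⟩ : Sym2 (ZMod n) → ℕ) s

lemma count_eq (n : ℕ) (R : Finset (ZMod n)) (d : ℕ) :
    Multiset.count d (pairDists n R) = (prs n R d).card := by
  unfold pairDists prs
  rw [Multiset.count_map]
  rfl

lemma mem_prs (n : ℕ) (R : Finset (ZMod n)) (d : ℕ) (x y : ZMod n) :
    s(x, y) ∈ prs n R d ↔ x ∈ R ∧ y ∈ R ∧ x ≠ y ∧ d = gg n (y - x) := by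
  unfold prs
  simp only [Finset.mem_filter, Finset.mk_mem_sym2_iff, Sym2.mk_isDiag_iff, Sym2.lift_mk, geo_eq]
  tauto

/-- translation overlap -/
def rr (n : ℕ) (R : Finset (ZMod n)) (d : ZMod n) : Finset (ZMod n) := R.filter fun x => x + d ∈ R

lemma mem_rr (n : ℕ) (R : Finset (ZMod n)) (d x : ZMod n) :
    x ∈ rr n R d ↔ x ∈ R ∧ x + d ∈ R := by simp [rr]

/-- multiplicity -/
def mu (n : ℕ) (R : Finset (ZMod n)) (d : ZMod n) : ℕ := (prs n R (gg n d)).card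

lemma prs_image (n : ℕ) [NeZero n] (R : Finset (ZMod n)) {d : ZMod n} (hd : d ≠ 0) :
    prs n R (gg n d) = (rr n R d).image (fun x => s(x, x + d)) := by
  ext s
  induction s using Sym2.ind with
  | _ x y =>
  rw [mem_prs]
  simp only [Finset.mem_image, mem_rr]
  constructor
  · rintro ⟨hx, hy, hxy, h⟩
    rcases gg_inj n h with h | h
    · exact ⟨x, ⟨hx, by rw [h]; simpa using hy⟩, by rw [h]; simp⟩
    · refine ⟨y, ⟨hy, by rw [h]; simpa using hx⟩, ?_⟩
      rw [h, Sym2.eq_swap]; simp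
  · rintro ⟨z, ⟨hz, hz'⟩, h⟩
    rw [Sym2.eq_iff] at h
    rcases h with ⟨rfl, rfl⟩ | ⟨rfl, rfl⟩
    · exact ⟨hz, hz', by simpa using hd, by simp⟩
    · refine ⟨hz', hz, by simpa using hd, ?_⟩
      rw [← gg_neg]; simp

lemma mu_eq (n : ℕ) [NeZero n] (R : Finset (ZMod n)) {d : ZMod n} (hd : d + d ≠ 0) :
    mu n R d = (rr n R d).card := by
  have hd0 : d ≠ 0 := by rintro rfl; simp at hd
  unfold mu
  rw [prs_image n R hd0, Finset.card_image_of_injective]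
  intro x y h
  simp only [Sym2.eq_iff] at h
  rcases h with ⟨h, _⟩ | ⟨h, h'⟩
  · exact h
  · exfalso; apply hd
    rw [h] at h'
    linear_combination h'

lemma mu_invol (n : ℕ) [NeZero n] (R : Finset (ZMod n)) {d : ZMod n} (hd0 : d ≠ 0) (hd : d + d = 0) :
    2 * mu n R d ≤ R.card := by
  unfold mu
  have h : ∀ s ∈ prs n R (gg n d), 2 ≤ ((R.filter fun x => s(x, x + d) = s).card) := by
    intro s hs
    rw [prs_image n R hd0, Finset.mem_image] at hs
    obtain ⟨x, hx, rfl⟩ := hs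
    rw [mem_rr] at hx
    have : ({x, x + d} : Finset (ZMod n)) ⊆ R.filter fun y => s(y, y + d) = s(x, x + d) := by
      intro y hy
      simp only [Finset.mem_insert, Finset.mem_singleton] at hy
      rw [Finset.mem_filter]
      rcases hy with rfl | rfl
      · exact ⟨hx.1, rfl⟩
      · refine ⟨hx.2, ?_⟩
        rw [add_assoc, hd, add_zero, Sym2.eq_swap]
    calc 2 = ({x, x + d} : Finset (ZMod n)).card := by
            rw [Finset.card_pair]; simpa using hd0
      _ ≤ _ := Finset.card_le_card this
  have h2 : ∑ s ∈ prs n R (gg n d), ((R.filter fun x => s(x, x + d) = s).card) ≤ R.card := by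
    rw [← Finset.card_biUnion]
    · apply Finset.card_le_card
      intro x hx
      simp only [Finset.mem_biUnion, Finset.mem_filter] at hx
      obtain ⟨_, _, h, _⟩ := hx
      exact h
    · intro s _ t _ hst
      show Disjoint _ _
      rw [Finset.disjoint_left]
      intro x hx hx'
      rw [Finset.mem_filter] at hx hx'
      exact hst (hx.2.symm.trans hx'.2)
  have h3 := Finset.sum_le_sum h
  rw [Finset.sum_const, smul_eq_mul] at h3
  linarith

lemma invol_unique (n : ℕ) [NeZero n] {d e : ZMod n} (hd0 : d ≠ 0) (hd : d + d = 0)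
    (he0 : e ≠ 0) (he : e + e = 0) : d = e := by
  have h1 := (ZMod.neg_eq_self_iff d).1 (by linear_combination -hd)
  have h2 := (ZMod.neg_eq_self_iff e).1 (by linear_combination -he)
  apply ZMod.val_injective n
  rcases h1 with h1 | h1
  · exact absurd h1 hd0
  rcases h2 with h2 | h2
  · exact absurd h2 he0
  omega

lemma deep_ex (n : ℕ) [NeZero n] {R : Finset (ZMod n)} (h : ErdosDeep n R) {i : ℕ} (h1 : 1 ≤ i)
    (h2 : i ≤ R.card - 1) : ∃ d, mu n R d = i := by
  obtain ⟨d, ⟨_, hd⟩, _⟩ := h i h1 h2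
  rw [count_eq] at hd
  have : (prs n R d).Nonempty := by rw [← Finset.card_pos]; omega
  obtain ⟨s, hs⟩ := this
  induction s using Sym2.ind with
  | _ x y =>
  rw [mem_prs] at hs
  refine ⟨y - x, ?_⟩
  unfold mu
  rw [← hs.2.2.2, hd]

lemma mu_pos (n : ℕ) [NeZero n] {R : Finset (ZMod n)} {d : ZMod n} (h : 1 ≤ mu n R d) :
    d ≠ 0 ∧ ∃ x ∈ R, x + d ∈ R := by
  have : (prs n R (gg n d)).Nonempty := by rw [← Finset.card_pos]; exact h
  obtain ⟨s, hs⟩ := this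
  have hd : d ≠ 0 := by
    rintro rfl
    induction s using Sym2.ind with
    | _ x y =>
    rw [mem_prs] at hs
    have := (gg_zero n).1 (hs.2.2.2.symm.trans ((gg_zero n).2 rfl))
    exact hs.2.2.1 (sub_eq_zero.1 this).symm
  refine ⟨hd, ?_⟩
  rw [prs_image n R hd, Finset.mem_image] at hs
  obtain ⟨x, hx, _⟩ := hs
  rw [mem_rr] at hx
  exact ⟨x, hx⟩

lemma deep_uniq (n : ℕ) [NeZero n] {R : Finset (ZMod n)} (h : ErdosDeep n R) {d e : ZMod n}
    (hde : mu n R d = mu n R e) (h1 : 1 ≤ mu n R d)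
    (h2 : mu n R d ≤ R.card - 1) : d = e ∨ d = -e := by
  apply gg_inj n
  apply (h _ h1 h2).unique
  · refine ⟨fun h0 => (mu_pos n h1).1 ((gg_zero n).1 h0), ?_⟩
    rw [count_eq]; rfl
  · refine ⟨fun h0 => (mu_pos n (hde ▸ h1)).1 ((gg_zero n).1 h0), ?_⟩
    rw [count_eq, hde]; rfl

/-- arithmetic progression -/
def ap (n : ℕ) (a m : ZMod n) (k : ℕ) : Finset (ZMod n) :=
  (Finset.range k).image fun j => a + j • m

lemma mem_ap (n : ℕ) (a m x : ZMod n) (k : ℕ) : x ∈ ap n a m k ↔ ∃ j < k, a + j • m = x := by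
  simp [ap]

lemma ap_count (n : ℕ) [NeZero n] (a m : ZMod n) (k : ℕ)
    (hm : ∀ j, 0 < j → j < 2 * (k - 1) → j • m ≠ 0) (t : ℕ) (ht : 1 ≤ t) (htk : t ≤ k - 1) :
    (prs n (ap n a m k) (gg n (t • m))).card = k - t := by
  have inj : ∀ i j : ℕ, i ≤ k - 1 → j ≤ k - 1 → i • m = j • m → i = j := by
    have key : ∀ i j : ℕ, i ≤ k - 1 → j ≤ k - 1 → i • m = j • m → ¬ i < j := by
      intro i j hi hj h hij
      apply hm (j - i) (by omega) (by omega)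
      obtain ⟨c, rfl⟩ := Nat.exists_eq_add_of_lt hij
      rw [show i + c + 1 - i = c + 1 by omega]
      rw [add_assoc, add_smul] at h
      simpa using h
    intro i j hi hj h
    have := key i j hi hj h
    have := key j i hj hi h.symm
    omega
  have finj : ∀ s, 1 ≤ s → s ≤ k - 1 → gg n (s • m) = gg n (t • m) → s = t := by
    intro s hs hsk h
    rcases gg_inj n h with h | h
    · exact inj _ _ hsk htk h
    · by_contra hst
      apply hm (s + t) (by omega) (by omega)
      rw [add_smul, h]; simp
  conv_rhs => rw [← Finset.card_range (k - t)]
  symm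
  apply Finset.card_bij (fun j _ => s(a + j • m, a + (j + t) • m))
  · intro j hj
    rw [Finset.mem_range] at hj
    rw [mem_prs, mem_ap, mem_ap]
    refine ⟨⟨j, by omega, rfl⟩, ⟨j + t, by omega, rfl⟩, ?_, ?_⟩
    · intro h
      have := inj _ _ (by omega) (by omega) (add_left_cancel h)
      omega
    · congr 1; rw [add_smul]; ring
  · intro i hi j hj h
    rw [Finset.mem_range] at hi hj
    rw [Sym2.eq_iff] at h
    rcases h with ⟨h, _⟩ | ⟨h, h'⟩
    · exact inj _ _ (by omega) (by omega) (add_left_cancel h)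
    · have := inj _ _ (by omega) (by omega) (add_left_cancel h)
      have := inj _ _ (by omega) (by omega) (add_left_cancel h')
      omega
  · have key : ∀ i j, i < j → j < k → gg n (t • m) = gg n ((a + j • m) - (a + i • m)) → j = i + t := by
      intro i j hij hj h
      have : (a + j • m) - (a + i • m) = (j - i) • m := by
        obtain ⟨c, rfl⟩ := Nat.exists_eq_add_of_lt hij
        rw [show i + c + 1 - i = c + 1 by omega, add_assoc, add_smul]; ring
      rw [this] at h
      have := finj _ (by omega) (by omega) h.symm
      omega
    intro s hs
    induction s using Sym2.ind with
    | _ x y =>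
    rw [mem_prs, mem_ap, mem_ap] at hs
    obtain ⟨⟨i, hi, rfl⟩, ⟨j, hj, rfl⟩, hne, h⟩ := hs
    rcases lt_trichotomy i j with hij | rfl | hij
    · have := key i j hij hj h
      subst this
      exact ⟨i, by rw [Finset.mem_range]; omega, rfl⟩
    · exact absurd rfl hne
    · rw [← gg_neg n (_ - _), neg_sub] at h
      have := key j i hij hi h
      subst this
      exact ⟨j, by rw [Finset.mem_range]; omega, Sym2.eq_swap⟩

lemma ap_deep (n : ℕ) [NeZero n] (a m : ZMod n) (k : ℕ)
    (hm : ∀ j, 0 < j → j < 2 * (k - 1) → j • m ≠ 0) : ErdosDeep n (ap n a m k) := by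
  intro i h1 h2
  have hc : (ap n a m k).card ≤ k := by
    unfold ap
    exact Finset.card_image_le.trans (by simp)
  have hcount := ap_count n a m k hm
  refine ⟨gg n ((k - i) • m), ⟨?_, ?_⟩, ?_⟩
  · intro h
    rw [gg_zero] at h
    exact hm (k - i) (by omega) (by omega) h
  · rw [count_eq, hcount _ (by omega) (by omega)]; omega
  · rintro d ⟨hd0, hd⟩
    rw [count_eq] at hd
    have : (prs n (ap n a m k) d).Nonempty := by rw [← Finset.card_pos]; omega
    obtain ⟨s, hs⟩ := this
    have key : ∀ i j, i < j → j < k → d = gg n ((a + j • m) - (a + i • m)) →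
        ∃ t, 1 ≤ t ∧ t ≤ k - 1 ∧ d = gg n (t • m) := by
      intro i j hij hj h
      refine ⟨j - i, by omega, by omega, ?_⟩
      rw [h]
      obtain ⟨c, rfl⟩ := Nat.exists_eq_add_of_lt hij
      rw [show i + c + 1 - i = c + 1 by omega, add_assoc, add_smul]; ring_nf
    have : ∃ t, 1 ≤ t ∧ t ≤ k - 1 ∧ d = gg n (t • m) := by
      induction s using Sym2.ind with
      | _ x y =>
      rw [mem_prs, mem_ap, mem_ap] at hs
      obtain ⟨⟨i, hi, rfl⟩, ⟨j, hj, rfl⟩, hne, h⟩ := hs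
      rcases lt_trichotomy i j with hij | rfl | hij
      · exact key i j hij hj h
      · exact absurd rfl hne
      · rw [← gg_neg n (_ - _), neg_sub] at h
        exact key j i hij hi h
    obtain ⟨t, ht, htk, rfl⟩ := this
    rw [hcount t ht htk] at hd
    rw [show k - i = t by omega]

/-- shellable -/
def Shell (n : ℕ) (R : Finset (ZMod n)) : Prop :=
    ∃ l : List (ZMod n), l.Nodup ∧ l.toFinset = R ∧
      ∀ i : ℕ, i ≤ l.length → ErdosDeep n (R \ (l.take i).toFinset)

lemma shell_cons (n : ℕ) {R : Finset (ZMod n)} {s : ZMod n} (hs : s ∉ R)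
    (hd : ErdosDeep n (insert s R)) (h : Shell n R) : Shell n (insert s R) := by
  obtain ⟨l, hl, rfl, hl2⟩ := h
  refine ⟨s :: l, ?_, by simp, ?_⟩
  · rw [List.nodup_cons]; exact ⟨by simpa using hs, hl⟩
  · intro i hi
    rcases i with _ | i
    · simpa using hd
    · have := hl2 i (by simpa using hi)
      convert this using 1
      ext x
      simp only [List.take_succ_cons, List.toFinset_cons, Finset.mem_sdiff, Finset.mem_insert]
      constructor
      · tauto
      · rintro ⟨h1, h2⟩
        refine ⟨Or.inr h1, ?_⟩
        rintro (rfl | h3)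
        · exact hs h1
        · exact h2 h3

lemma ap_succ (n : ℕ) (a m : ZMod n) (k : ℕ) :
    ap n a m (k + 1) = insert (a + k • m) (ap n a m k) := by
  unfold ap; rw [Finset.range_add_one, Finset.image_insert]

lemma ap_shell (n : ℕ) [NeZero n] (a m : ZMod n) (k : ℕ)
    (hm : ∀ j, 0 < j → j ≤ k - 1 → j • m ≠ 0)
    (hm2 : ∀ j, 0 < j → j < 2 * (k - 1) → j • m ≠ 0) : Shell n (ap n a m k) := by
  induction k with
  | zero =>
    refine ⟨[], by simp, by simp [ap], ?_⟩
    intro i _ j h1 h2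
    simp [ap] at h2; omega
  | succ k ih =>
    have hd := ap_deep n a m (k + 1) hm2
    rw [ap_succ] at hd ⊢
    refine shell_cons n ?_ hd (ih (fun j h1 h2 => hm j h1 (by omega)) (fun j h1 h2 => hm2 j h1 (by omega)))
    rw [mem_ap]
    rintro ⟨j, hj, h⟩
    apply hm (k - j) (by omega) (by omega)
    obtain ⟨c, rfl⟩ := Nat.exists_eq_add_of_lt hj
    rw [show j + c + 1 - j = c + 1 by omega]
    rw [add_assoc j, add_smul] at h
    have h := add_left_cancel h
    simpa using h

lemma mem_H (n : ℕ) [NeZero n] {m d : ZMod n} (h : d ∈ AddSubgroup.zmultiples m) :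
    ∃ j < addOrderOf m, d = j • m := by
  rw [(isOfFinAddOrder_of_finite m).mem_zmultiples_iff_mem_range_addOrderOf, Finset.mem_image] at h
  obtain ⟨j, hj, rfl⟩ := h
  exact ⟨j, by simpa using hj, rfl⟩

lemma full_coset (n : ℕ) [NeZero n] {R : Finset (ZMod n)} {m x0 : ZMod n}
    (hx : ∀ x ∈ R, x ≠ x0 → x + m ∈ R) {z w : ZMod n} (hz : z ∈ R)
    (hzH : z - x0 ∉ AddSubgroup.zmultiples m) (hw : w - z ∈ AddSubgroup.zmultiples m) : w ∈ R := by
  obtain ⟨j, _, hj⟩ := mem_H n hw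
  have : ∀ j : ℕ, z + j • m ∈ R := by
    intro j
    induction j with
    | zero => simpa using hz
    | succ j ih =>
      have h1 : z + j • m ≠ x0 := by
        intro h
        apply hzH
        have : z - x0 = -(j • m) := by linear_combination h
        rw [this]
        exact neg_mem (nsmul_mem (AddSubgroup.mem_zmultiples m) j)
      have := hx _ ih h1
      rwa [add_assoc, ← succ_nsmul] at this
  have h := this j
  rw [← hj] at h
  simpa using h

lemma rr_shift (n : ℕ) [NeZero n] {R : Finset (ZMod n)} {m x0 : ZMod n}
    (hx : ∀ x ∈ R, x ≠ x0 → x + m ∈ R) {d : ZMod n}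
    (hd : d ∉ AddSubgroup.zmultiples m) : (rr n R (d + m)).card = (rr n R d).card := by
  classical
  have hm := AddSubgroup.mem_zmultiples m
  have F : ∀ z w, z ∈ R → z - x0 ∉ AddSubgroup.zmultiples m → w - z ∈ AddSubgroup.zmultiples m → w ∈ R :=
    fun z w => full_coset n hx
  have e1 : ∀ x, x - m - x0 ∈ AddSubgroup.zmultiples m ↔ x - x0 ∈ AddSubgroup.zmultiples m := by
    intro x
    rw [show x - m - x0 = (x - x0) - m by ring]
    rw [sub_eq_add_neg]
    exact AddSubgroup.add_mem_cancel_right _ (neg_mem hm)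
  have e2 : ∀ x, x + m - x0 ∈ AddSubgroup.zmultiples m ↔ x - x0 ∈ AddSubgroup.zmultiples m := by
    intro x
    rw [← e1 (x + m)]; simp
  have hD : ∀ x, x - x0 ∈ AddSubgroup.zmultiples m → x + d - x0 ∉ AddSubgroup.zmultiples m := by
    intro x h1 h2
    apply hd
    have := sub_mem h2 h1
    simpa using this
  symm
  apply Finset.card_nbij' (fun x => if x - x0 ∈ AddSubgroup.zmultiples m then x else x - m)
    (fun x => if x - x0 ∈ AddSubgroup.zmultiples m then x else x + m)
  · intro x h
    rw [Finset.mem_coe, mem_rr] at h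
    rw [Finset.mem_coe]
    dsimp only
    split_ifs with hH
    · rw [mem_rr]
      exact ⟨h.1, F _ _ h.2 (hD x hH) (by rw [show x + (d + m) - (x + d) = m by ring]; exact hm)⟩
    · rw [mem_rr]
      refine ⟨F _ _ h.1 hH (by rw [show x - m - x = -m by ring]; exact neg_mem hm), ?_⟩
      rw [show x - m + (d + m) = x + d by ring]; exact h.2
  · intro x h
    rw [Finset.mem_coe, mem_rr] at h
    rw [Finset.mem_coe]
    dsimp only
    split_ifs with hH
    · rw [mem_rr]
      refine ⟨h.1, F _ _ h.2 ?_ (by rw [show x + d - (x + (d + m)) = -m by ring]; exact neg_mem hm)⟩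
      have := hD x hH
      rw [← e2] at this
      rwa [← add_assoc]
    · rw [mem_rr]
      refine ⟨F _ _ h.1 hH (by rw [show x + m - x = m by ring]; exact hm), ?_⟩
      rw [show x + m + d = x + (d + m) by ring]; exact h.2
  · intro x h
    dsimp only
    by_cases hH : x - x0 ∈ AddSubgroup.zmultiples m
    · simp [hH]
    · simp [hH, e1]
  · intro x h
    dsimp only
    by_cases hH : x - x0 ∈ AddSubgroup.zmultiples m
    · simp [hH]
    · simp [hH, e2]

lemma invol_of (n : ℕ) [NeZero n] {R : Finset (ZMod n)} {m x0 : ZMod n} (hR : ErdosDeep n R)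
    (hx0 : x0 ∈ R)
    (hx : ∀ x ∈ R, x ≠ x0 → x + m ∈ R) (hm2 : m + m ≠ 0)
    (hle : ∀ d, d ≠ 0 → (rr n R d).card ≤ R.card - 1) {z : ZMod n} (hz : z ∈ R)
    (hzH : z - x0 ∉ AddSubgroup.zmultiples m) :
    ∃ e, e + e = 0 ∧ e ≠ 0 ∧ e ∉ AddSubgroup.zmultiples m ∧ x0 - z - e ∈ AddSubgroup.zmultiples m ∧
      m + m + m = 0 := by
  have hm := AddSubgroup.mem_zmultiples m
  have hm0 : m ≠ 0 := by rintro rfl; simp at hm2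
  have hn0 : ∀ d, d ∉ AddSubgroup.zmultiples m → d ≠ 0 := by
    rintro d h rfl; exact h (zero_mem _)
  have hadd : ∀ d, d ∉ AddSubgroup.zmultiples m → d + m ∉ AddSubgroup.zmultiples m := by
    intro d h h'; exact h ((AddSubgroup.add_mem_cancel_right _ hm).1 h')
  have uniq : ∀ d e, d ≠ 0 → d + d ≠ 0 → e + e ≠ 0 → (rr n R d).card = (rr n R e).card →
      1 ≤ (rr n R d).card → d = e ∨ d = -e := by
    intro d e hd0 hd he h h1
    have hh := hle d hd0
    rw [← mu_eq n R hd] at h h1 hh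
    rw [← mu_eq n R he] at h
    exact deep_uniq n hR h h1 hh
  have hex : ∃ e, e + e = 0 ∧ e ∉ AddSubgroup.zmultiples m ∧ x0 - z - e ∈ AddSubgroup.zmultiples m := by
    have hd : x0 - z ∉ AddSubgroup.zmultiples m := by
      intro h; apply hzH; rw [← neg_sub]; exact neg_mem h
    by_contra hno
    push Not at hno
    have g0 : (x0 - z) + (x0 - z) ≠ 0 := fun h => hno _ h hd (by simp)
    have g1 : (x0 - z + m) + (x0 - z + m) ≠ 0 := fun h => hno _ h (hadd _ hd) (by
      rw [show x0 - z - (x0 - z + m) = -m by ring]; exact neg_mem hm)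
    have g2 : (x0 - z + m + m) + (x0 - z + m + m) ≠ 0 := fun h => hno _ h (hadd _ (hadd _ hd)) (by
      rw [show x0 - z - (x0 - z + m + m) = -(m + m) by ring]; exact neg_mem (add_mem hm hm))
    have s1 := rr_shift n hx hd
    have s2 := rr_shift n hx (hadd _ hd)
    have hpos : 1 ≤ (rr n R (x0 - z)).card := by
      rw [Nat.one_le_iff_ne_zero, ← Nat.pos_iff_ne_zero, Finset.card_pos]
      exact ⟨z, by rw [mem_rr]; exact ⟨hz, by simpa using hx0⟩⟩
    have u1 := uniq _ _ (hn0 _ hd) g0 g1 s1.symm hpos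
    have u2 := uniq _ _ (hn0 _ hd) g0 g2 (s2.trans s1).symm hpos
    rcases u1 with u1 | u1
    · apply hm0; linear_combination -u1
    rcases u2 with u2 | u2
    · apply hm2; linear_combination -u2
    · apply hm0; linear_combination u2 - u1
  obtain ⟨e, he2, heH, hez⟩ := hex
  refine ⟨e, he2, hn0 _ heH, heH, hez, ?_⟩
  have hz' : x0 - e ∈ R := full_coset n hx hz hzH (by
    rw [show x0 - e - z = x0 - z - e by ring]; exact hez)
  have s1 := rr_shift n hx heH
  have s2 := rr_shift n hx (hadd _ heH)
  have hpos : 1 ≤ (rr n R e).card := by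
    rw [Nat.one_le_iff_ne_zero, ← Nat.pos_iff_ne_zero, Finset.card_pos]
    exact ⟨x0 - e, by rw [mem_rr]; exact ⟨hz', by simpa using hx0⟩⟩
  by_cases h4 : (m + m) + (m + m) = 0
  · exfalso
    have := invol_unique n hm2 h4 (hn0 _ heH) he2
    exact heH (this ▸ add_mem hm hm)
  · have u := uniq (e + m) (e + m + m) (hn0 _ (hadd _ heH))
      (by intro h; apply hm2; linear_combination h - he2)
      (by intro h; apply h4; linear_combination h - he2) s2.symm (by omega)
    rcases u with u | u
    · exfalso; apply hm0; linear_combination -u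
    · linear_combination u - he2

lemma main_shell (n : ℕ) [NeZero n] {R : Finset (ZMod n)} (hR : ErdosDeep n R) (hk : 3 ≤ R.card) :
    Shell n R := by
  obtain ⟨m, hmu⟩ := deep_ex n hR (i := R.card - 1) (by omega) le_rfl
  have hm0 : m ≠ 0 := (mu_pos n (R := R) (by rw [hmu]; omega)).1
  have hm2 : m + m ≠ 0 := by
    intro h
    have := mu_invol n R hm0 h
    omega
  have hrm : (rr n R m).card = R.card - 1 := by rw [← mu_eq n R hm2, hmu]
  have hsub : ∀ d, rr n R d ⊆ R := fun d => Finset.filter_subset _ _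
  have h1 : (R \ rr n R m).card = 1 := by
    rw [Finset.card_sdiff_of_subset (hsub m)]; omega
  obtain ⟨x0, hx0'⟩ := Finset.card_eq_one.1 h1
  have hxx : ∀ x, (x ∈ R ∧ x + m ∉ R) ↔ x = x0 := by
    intro x
    rw [← Finset.mem_singleton, ← hx0', Finset.mem_sdiff, mem_rr]
    tauto
  obtain ⟨hx0, hx0m⟩ := (hxx x0).2 rfl
  have hx : ∀ x ∈ R, x ≠ x0 → x + m ∈ R := by
    intro x h h'
    by_contra h2
    exact h' ((hxx x).1 ⟨h, h2⟩)
  have hle : ∀ d, d ≠ 0 → (rr n R d).card ≤ R.card - 1 := by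
    intro d hd
    by_contra hlt
    have heq : rr n R d = R := Finset.eq_of_subset_of_card_le (hsub d) (by omega)
    have hall : ∀ x ∈ R, x + d ∈ R := by
      intro x h; rw [← heq, mem_rr] at h; exact h.2
    have himg : R.image (· + d) = R := by
      apply Finset.eq_of_subset_of_card_le
      · intro y hy
        rw [Finset.mem_image] at hy
        obtain ⟨x, h, rfl⟩ := hy
        exact hall x h
      · rw [Finset.card_image_of_injective _ (add_left_injective d)]
    have := (hxx (x0 + d)).1 ⟨hall _ hx0, by
      intro h
      rw [← himg, Finset.mem_image] at h
      obtain ⟨w, hw, hw2⟩ := h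
      apply hx0m
      have : w = x0 + m := by linear_combination hw2
      rwa [← this]⟩
    apply hd
    simpa using this
  have hm := AddSubgroup.mem_zmultiples m
  by_cases hfull : ∃ z ∈ R, z - x0 ∉ AddSubgroup.zmultiples m
  · obtain ⟨z, hz, hzH⟩ := hfull
    obtain ⟨e, he2, he0, heH, hez, h3⟩ := invol_of n hR hx0 hx hm2 hle hz hzH
    have hH : ∀ d ∈ AddSubgroup.zmultiples m, d = 0 ∨ d = m ∨ d = -m := by
      intro d hd
      obtain ⟨j, hj, rfl⟩ := mem_H n hd
      have : addOrderOf m ≤ 3 := addOrderOf_le_of_nsmul_eq_zero (by norm_num) (by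
        rw [succ_nsmul, two_nsmul]; exact h3)
      have hj : j < 3 := by omega
      interval_cases j
      · left; simp
      · right; left; simp
      · right; right; rw [two_nsmul]; linear_combination h3
    have hC : ∀ d ∈ AddSubgroup.zmultiples m, x0 + e + d ∈ R := by
      intro d hd
      refine full_coset n hx hz hzH ?_
      rw [show x0 + e + d - z = (x0 - z - e) + d by linear_combination he2]
      exact add_mem hez hd
    have c0 : x0 + e ∈ R := by simpa using hC 0 (zero_mem _)
    have c1 : x0 + e + m ∈ R := hC _ hm
    have c2 : x0 + e - m ∈ R := by simpa [sub_eq_add_neg] using hC _ (neg_mem hm)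
    have hsubR : ∀ w ∈ R, w = x0 ∨ w = x0 - m ∨ w = x0 + e ∨ w = x0 + e + m ∨ w = x0 + e - m := by
      intro w hw
      by_cases hwH : w - x0 ∈ AddSubgroup.zmultiples m
      · rcases hH _ hwH with h | h | h
        · left; linear_combination h
        · exfalso; apply hx0m
          rw [← show w = x0 + m by linear_combination h]; exact hw
        · right; left; linear_combination h
      · obtain ⟨e', he2', he0', _, hez', _⟩ := invol_of n hR hx0 hx hm2 hle hw hwH
        have := invol_unique n he0' he2' he0 he2
        subst this
        rcases hH _ hez' with h | h | h
        · right; right; left; linear_combination - h - he2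
        · right; right; right; right; linear_combination - h - he2
        · right; right; right; left; linear_combination - h - he2
    have heM : ∀ d ∈ AddSubgroup.zmultiples m, e ≠ d := fun d hd h => heH (h ▸ hd)
    have q1 : e ≠ m := heM _ hm
    have q2 : e ≠ -m := heM _ (neg_mem hm)
    have hno : x0 - m ∉ R := by
      intro hc
      have hS : ({x0, x0 - m, x0 + e, x0 + e - m} : Finset (ZMod n)) ⊆ rr n R e := by
        intro y hy
        simp only [Finset.mem_insert, Finset.mem_singleton] at hy
        rw [mem_rr]
        rcases hy with rfl | rfl | rfl | rfl
        · exact ⟨hx0, c0⟩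
        · exact ⟨hc, by rw [show x0 - m + e = x0 + e - m by ring]; exact c2⟩
        · exact ⟨c0, by rw [show x0 + e + e = x0 by linear_combination he2]; exact hx0⟩
        · exact ⟨c2, by rw [show x0 + e - m + e = x0 - m by linear_combination he2]; exact hc⟩
      have hS4 : ({x0, x0 - m, x0 + e, x0 + e - m} : Finset (ZMod n)).card = 4 := by
        rw [Finset.card_insert_of_notMem, Finset.card_insert_of_notMem, Finset.card_pair]
        · intro h; apply hm0; linear_combination h
        · simp only [Finset.mem_insert, Finset.mem_singleton]
          rintro (h | h)
          · apply q2; linear_combination -h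
          · apply he0; linear_combination -h
        · simp only [Finset.mem_insert, Finset.mem_singleton]
          rintro (h | h | h)
          · apply hm0; linear_combination h
          · apply he0; linear_combination -h
          · apply q1; linear_combination -h
      have hR5 : R.card ≤ 5 := by
        have : R ⊆ ({x0, x0 - m, x0 + e, x0 + e + m, x0 + e - m} : Finset (ZMod n)) := by
          intro w hw
          simpa using hsubR w hw
        exact (Finset.card_le_card this).trans Finset.card_le_five
      have hge := Finset.card_le_card hS
      have hle' := hle e he0
      have hsh := rr_shift n hx heH
      have hem : (e + m) + (e + m) ≠ 0 := by
        intro h; apply hm2; linear_combination h - he2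
      rw [← mu_eq n R hem] at hsh
      rcases deep_uniq n hR (d := e + m) (e := m) (by omega) (by omega) (by omega) with h | h
      · apply he0; linear_combination h
      · exact heM _ (neg_mem (add_mem hm hm)) (by linear_combination h)
    have hRe : R = insert (x0 + e) (ap n (x0 - (e + m)) (e + m) 3) := by
      ext w
      rw [Finset.mem_insert, mem_ap]
      constructor
      · intro hw
        rcases hsubR w hw with h | h | h | h | h
        · right; exact ⟨1, by norm_num, by rw [h]; simp⟩
        · exfalso; rw [h] at hw; exact hno hw
        · left; exact h
        · right; exact ⟨2, by norm_num, by rw [h, two_nsmul]; ring⟩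
        · right; exact ⟨0, by norm_num, by rw [h, zero_nsmul]; linear_combination -he2⟩
      · rintro (h | ⟨j, hj, h⟩)
        · rw [h]; exact c0
        · rw [← h]
          interval_cases j
          · rw [zero_nsmul, show x0 - (e + m) + 0 = x0 + e - m by linear_combination -he2]; exact c2
          · rw [one_nsmul, sub_add_cancel]; exact hx0
          · rw [two_nsmul, show x0 - (e + m) + (e + m + (e + m)) = x0 + e + m by ring]; exact c1
    have hg : ∀ j, 0 < j → j < 4 → j • (e + m) ≠ 0 := by
      intro j hj hj4 h
      interval_cases j
      · rw [one_nsmul] at h; apply q2; linear_combination h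
      · rw [two_nsmul] at h; apply hm2; linear_combination h - he2
      · rw [succ_nsmul, two_nsmul] at h; apply he0; linear_combination h - he2 - h3
    rw [hRe]
    apply shell_cons
    · rw [mem_ap]
      rintro ⟨j, hj, h⟩
      interval_cases j
      · rw [zero_nsmul] at h; apply hm0; linear_combination - h - he2
      · rw [one_nsmul] at h; apply he0; linear_combination - h
      · rw [two_nsmul] at h; apply hm0; linear_combination h
    · rw [← hRe]; exact hR
    · exact ap_shell n _ _ 3 (fun j h1 h2 => hg j h1 (by omega)) (fun j h1 h2 => hg j h1 (by omega))
  · push Not at hfull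
    have hhpos : 0 < addOrderOf m := addOrderOf_pos m
    obtain ⟨h, hh⟩ : ∃ h, h = addOrderOf m := ⟨_, rfl⟩
    rw [← hh] at hhpos
    have hmz : ∀ j, 0 < j → j < h → j • m ≠ 0 := by
      intro j h1 h2
      exact nsmul_ne_zero_of_lt_addOrderOf (by omega) (by omega)
    have hmh : h • m = 0 := by rw [hh]; exact addOrderOf_nsmul_eq_zero m
    have hex : ∃ j, j = h ∨ x0 + j • (-m) ∉ R := ⟨h, Or.inl rfl⟩
    classical
    obtain ⟨c, hc, hcmin⟩ : ∃ c, (c = h ∨ x0 + c • (-m) ∉ R) ∧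
        ∀ j < c, j ≠ h ∧ x0 + j • (-m) ∈ R := by
      refine ⟨Nat.find hex, Nat.find_spec hex, ?_⟩
      intro j hj
      have := Nat.find_min hex hj
      push Not at this
      exact this
    have hch : c ≤ h := by
      by_contra hlt
      exact (hcmin h (by omega)).1 rfl
    have hdown : ∀ i j, j + i < h → x0 + (j + i) • (-m) ∈ R → x0 + j • (-m) ∈ R := by
      intro i
      induction i with
      | zero => intro j _ h; exact h
      | succ i ih =>
        intro j hj hjR
        apply ih j (by omega)
        have := hx _ hjR (by
          intro hcon
          apply hmz (j + (i + 1)) (by omega) hj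
          rw [smul_neg] at hcon
          linear_combination -hcon)
        rw [← add_assoc j i 1, succ_nsmul] at this
        convert this using 1
        ring
    have hRap : R = ap n x0 (-m) c := by
      ext w
      rw [mem_ap]
      constructor
      · intro hw
        have hw' := hfull w hw
        obtain ⟨j, hj, hjw⟩ := mem_H n (neg_mem hw')
        have hwj : x0 + j • (-m) = w := by
          rw [smul_neg]; linear_combination hjw
        refine ⟨j, ?_, hwj⟩
        by_contra hcj
        rcases hc with hc | hc
        · omega
        · apply hc
          apply hdown (j - c) c (by omega)
          rw [show c + (j - c) = j by omega, hwj]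
          exact hw
      · rintro ⟨j, hj, rfl⟩
        exact (hcmin j hj).2
    have hcc : R.card = c := by
      conv_lhs => rw [hRap]
      unfold ap
      rw [Finset.card_image_of_injOn, Finset.card_range]
      have key : ∀ i j, i < j → j < c → x0 + i • (-m) ≠ x0 + j • (-m) := by
        intro i j hij hj heq
        apply hmz (j - i) (by omega) (by omega)
        obtain ⟨t, rfl⟩ := Nat.exists_eq_add_of_lt hij
        rw [show i + t + 1 - i = t + 1 by omega]
        rw [add_assoc i, add_smul] at heq
        have heq := add_left_cancel heq
        simpa using heq
      intro i hi j hj heq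
      simp only [Finset.coe_range, Set.mem_Iio] at hi hj
      rcases lt_trichotomy i j with h | h | h
      · exact absurd heq (key i j h hj)
      · exact h
      · exact absurd heq.symm (key j i h hi)
    have hcount : 2 * (c - 1) ≤ h := by
      have hsubset : Finset.Icc 1 (c - 1) ⊆ (Finset.Icc 1 (h / 2)).image (fun t => mu n R (t • m)) := by
        intro i hi
        rw [Finset.mem_Icc] at hi
        obtain ⟨d, hd⟩ := deep_ex n hR hi.1 (by omega)
        obtain ⟨hd0, x, hxR, hxd⟩ := mu_pos n (R := R) (d := d) (by omega)
        have hdH : d ∈ AddSubgroup.zmultiples m := by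
          have := sub_mem (hfull _ hxd) (hfull _ hxR)
          simpa using this
        obtain ⟨j, hj, rfl⟩ := mem_H n hdH
        have hj0 : j ≠ 0 := by rintro rfl; simp at hd0
        rw [Finset.mem_image]
        by_cases hj2 : j ≤ h / 2
        · exact ⟨j, by rw [Finset.mem_Icc]; omega, hd⟩
        · refine ⟨h - j, by rw [Finset.mem_Icc]; omega, ?_⟩
          rw [← hd]
          have : (h - j) • m = -(j • m) := by
            rw [eq_neg_iff_add_eq_zero, ← add_smul, Nat.sub_add_cancel (by omega), hmh]
          unfold mu
          rw [this, gg_neg]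
      have := (Finset.card_le_card hsubset).trans Finset.card_image_le
      simp only [Nat.card_Icc] at this
      omega
    rw [hRap]
    have hneg : ∀ j, 0 < j → j < h → j • (-m) ≠ 0 := by
      intro j h1 h2 h3
      rw [smul_neg, neg_eq_zero] at h3
      exact hmz j h1 h2 h3
    exact ap_shell n _ _ c (fun j h1 h2 => hneg j h1 (by omega)) (fun j h1 h2 => hneg j h1 (by omega))

/-- Every Erdős-deep rhythm has a shelling: an ordering `s₁, …, s_k` of its
onsets such that removing `s₁, …, s_i` leaves an Erdős-deep rhythm for every
`i ∈ [0, k]`. -/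
theorem stmt_16 (n : ℕ) (hn : 0 < n) (R : Finset (ZMod n)) (hdeep : ErdosDeep n R) :
    ∃ l : List (ZMod n), l.Nodup ∧ l.toFinset = R ∧
      ∀ i : ℕ, i ≤ l.length → ErdosDeep n (R \ (l.take i).toFinset) := by
  haveI : NeZero n := ⟨hn.ne'⟩
  change Shell n R
  by_cases hk : 3 ≤ R.card
  · exact main_shell n hdeep hk
  have hk' : R.card ≤ 2 := by omega
  interval_cases hc : R.card
  · rw [Finset.card_eq_zero] at hc
    subst hc
    exact ap_shell n 0 0 0 (fun j h1 h2 => by omega) (fun j h1 h2 => by omega)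
  · obtain ⟨a, rfl⟩ := Finset.card_eq_one.1 hc
    have : ({a} : Finset (ZMod n)) = ap n a 0 1 := by simp [ap]
    rw [this]
    exact ap_shell n a 0 1 (fun j h1 h2 => by omega) (fun j h1 h2 => by omega)
  · obtain ⟨a, b, hab, rfl⟩ := Finset.card_eq_two.1 hc
    have : ({a, b} : Finset (ZMod n)) = ap n a (b - a) 2 := by
      ext w
      rw [mem_ap, Finset.mem_insert, Finset.mem_singleton]
      constructor
      · rintro (rfl | rfl)
        · exact ⟨0, by norm_num, by simp⟩
        · exact ⟨1, by norm_num, by simp⟩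
      · rintro ⟨j, hj, rfl⟩
        interval_cases j
        · left; simp
        · right; simp
    rw [this]
    have hb : b - a ≠ 0 := sub_ne_zero.2 hab.symm
    exact ap_shell n a (b - a) 2
      (fun j h1 h2 => by rw [show j = 1 by omega, one_nsmul]; exact hb)
      (fun j h1 h2 => by rw [show j = 1 by omega, one_nsmul]; exact hb)
end
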